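/- arXiv:0908.3293 — 2 statements merged into one kernel-verified Lean document; each statement's English description precedes it below -/
import Mathlib

section
/- Let n ≥ 1, let 0 < τ₁ < τ₂, and let A : ℝ → Matrix (Fin n) (Fin n) ℝ be twice continuously differentiable on [τ₁,τ₂] with A(τ) invertible for every τ ∈ [τ₁,τ₂], and suppose A satisfies A''(τ) + (1/(2τ))·A'(τ) = M(τ)·A(τ) on [τ₁,τ₂], where M : ℝ → Matrix (Fin n) (Fin n) ℝ is continuous. Define α(τ) := -(1/2)·log(det(A(τ)ᵀ·A(τ))) and B(τ) := A'(τ)·A(τ)⁻¹. Then for every τ ∈ [τ₁,τ₂]: τ^(-3/2) · d/dτ(τ^(3/2) · α'(τ)) = trace((B(τ) - (1/(2τ))·1)²) - trace(M(τ)) - n/(4τ²), where 1 denotes the identity matrix. -/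
open Matrix Set

/-- **Jacobi formula**: the derivative of the determinant of a differentiable matrix function,
with derivatives taken entrywise. -/
theorem hasDerivWithinAt_det {ι : Type*} [Fintype ι] [DecidableEq ι] {A : ℝ → Matrix ι ι ℝ}
    {A' : Matrix ι ι ℝ} {s : Set ℝ} {x : ℝ}
    (hA : ∀ i j, HasDerivWithinAt (fun t => A t i j) (A' i j) s x) :
    HasDerivWithinAt (fun t => (A t).det) ((A x).adjugate * A').trace s x := by
  have key : HasDerivWithinAt (fun t => ∑ σ : Equiv.Perm ι,
      ((Equiv.Perm.sign σ : ℤ) : ℝ) * ∏ i, A t (σ i) i) _ s x :=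
    HasDerivWithinAt.fun_sum fun σ _ =>
      (HasDerivWithinAt.fun_finsetProd fun i _ => hA (σ i) i).const_mul _
  simp only [det_apply']
  convert! key using 1
  have hcol (j : ι) : ((A x).adjugate * A') j j
      = ((A x).updateCol j fun i => A' i j).det := by
    rw [← cramer_apply, cramer_eq_adjugate_mulVec]
    rfl
  simp only [trace, diag_apply, hcol, det_apply', Finset.mul_sum]
  rw [Finset.sum_comm]
  refine Finset.sum_congr rfl fun σ _ => Finset.sum_congr rfl fun j _ => ?_
  rw [← Finset.prod_erase_mul _ _ (Finset.mem_univ j), updateCol_self, smul_eq_mul]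
  congr 2
  exact Finset.prod_congr rfl fun i hi => updateCol_ne (Finset.ne_of_mem_erase hi)

section Norm

attribute [local instance] Matrix.linftyOpNormedRing Matrix.linftyOpNormedAlgebra

private theorem hasDerivWithinAt_of_entries {ι : Type*} [Fintype ι] [DecidableEq ι]
    {A : ℝ → Matrix ι ι ℝ} {A' : Matrix ι ι ℝ} {s : Set ℝ} {x : ℝ}
    (hA : ∀ i j, HasDerivWithinAt (fun t => A t i j) (A' i j) s x) :
    HasDerivWithinAt A A' s x := by
  have key : HasDerivWithinAt
      (fun t => ∑ i, ∑ j, A t i j • (single i j 1 : Matrix ι ι ℝ))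
      (∑ i, ∑ j, A' i j • (single i j 1 : Matrix ι ι ℝ)) s x :=
    HasDerivWithinAt.fun_sum fun i _ => HasDerivWithinAt.fun_sum fun j _ =>
      (hA i j).smul_const _
  simpa only [smul_single, smul_eq_mul, mul_one, ← matrix_eq_sum_single] using key

/-- The derivative of `trace (C * A⁻¹)` along differentiable matrix functions, with derivatives
taken entrywise. -/
theorem hasDerivWithinAt_trace_mul_inv {ι : Type*} [Fintype ι] [DecidableEq ι]
    {A C : ℝ → Matrix ι ι ℝ} {A' C' : Matrix ι ι ℝ} {s : Set ℝ} {x : ℝ}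
    (hA : ∀ i j, HasDerivWithinAt (fun t => A t i j) (A' i j) s x)
    (hC : ∀ i j, HasDerivWithinAt (fun t => C t i j) (C' i j) s x) (hx : IsUnit (A x)) :
    HasDerivWithinAt (fun t => (C t * (A t)⁻¹).trace)
      (C' * (A x)⁻¹ - C x * ((A x)⁻¹ * A' * (A x)⁻¹)).trace s x := by
  have hinv : HasDerivWithinAt (fun t => (A t)⁻¹) (-((A x)⁻¹ * A' * (A x)⁻¹)) s x := by
    obtain ⟨u, hu⟩ := hx
    have h := hasFDerivAt_ringInverse (𝕜 := ℝ) u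
    rw [hu] at h
    have h2 := h.comp_hasDerivWithinAt x (hasDerivWithinAt_of_entries hA)
    simp only [nonsing_inv_eq_ringInverse]
    convert! h2 using 1
    simp [← hu]
  have h := (traceLinearMap ι ℝ ℝ).toContinuousLinearMap.hasFDerivAt.comp_hasDerivWithinAt x
    ((hasDerivWithinAt_of_entries hC).fun_mul hinv)
  convert! h using 1
  rw [sub_eq_add_neg, ← mul_neg]
  rfl

end Norm

theorem matrix_ode_log_det_identity_two
    (n : ℕ) (hn : 1 ≤ n) (τ₁ τ₂ : ℝ) (hτ₁ : 0 < τ₁) (hτ₁₂ : τ₁ < τ₂)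
    (A A' A'' M : ℝ → Matrix (Fin n) (Fin n) ℝ)
    -- A is twice continuously differentiable on [τ₁,τ₂], with entrywise
    -- first derivative A' and second derivative A''
    (hA' : ∀ τ ∈ Icc τ₁ τ₂, ∀ i j,
      HasDerivWithinAt (fun t => A t i j) (A' τ i j) (Icc τ₁ τ₂) τ)
    (hA'' : ∀ τ ∈ Icc τ₁ τ₂, ∀ i j,
      HasDerivWithinAt (fun t => A' t i j) (A'' τ i j) (Icc τ₁ τ₂) τ)
    (hA''cont : ∀ i j, ContinuousOn (fun t => A'' t i j) (Icc τ₁ τ₂))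
    -- A(τ) is invertible on [τ₁,τ₂]
    (hinv : ∀ τ ∈ Icc τ₁ τ₂, IsUnit (A τ))
    -- M is continuous
    (hM : ∀ i j, ContinuousOn (fun t => M t i j) (Icc τ₁ τ₂))
    -- the second-order linear ODE  A'' + (1/(2τ))·A' = M·A
    (hODE : ∀ τ ∈ Icc τ₁ τ₂, A'' τ + (1 / (2 * τ)) • A' τ = M τ * A τ)
    -- α(τ) := -(1/2)·log det(Aᵀ A)  and  B(τ) := A'·A⁻¹
    (α : ℝ → ℝ) (hα : ∀ τ, α τ = -(1 / 2) * Real.log ((A τ)ᵀ * A τ).det)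
    (B : ℝ → Matrix (Fin n) (Fin n) ℝ) (hB : ∀ τ, B τ = A' τ * (A τ)⁻¹) :
    ∀ τ ∈ Icc τ₁ τ₂,
      τ ^ (-(3 : ℝ) / 2) *
          derivWithin (fun t => t ^ ((3 : ℝ) / 2) * derivWithin α (Icc τ₁ τ₂) t) (Icc τ₁ τ₂) τ
        = ((B τ - (1 / (2 * τ)) • (1 : Matrix (Fin n) (Fin n) ℝ)) ^ 2).trace
            - (M τ).trace - n / (4 * τ ^ 2) := by
  intro τ hτ
  have hud := uniqueDiffOn_Icc hτ₁₂
  have hτ0 : 0 < τ := hτ₁.trans_le hτ.1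
  have hαlog (t : ℝ) : α t = -Real.log (A t).det := by
    rw [hα, det_mul, det_transpose, ← sq, Real.log_pow]
    push_cast
    ring
  have hderiv : ∀ t ∈ Icc τ₁ τ₂, derivWithin α (Icc τ₁ τ₂) t = -(A' t * (A t)⁻¹).trace := by
    intro t ht
    have hdet : (A t).det ≠ 0 := ((isUnit_iff_isUnit_det _).1 (hinv t ht)).ne_zero
    have h := ((hasDerivWithinAt_det (hA' t ht)).log hdet).fun_neg
    rw [funext hαlog, h.derivWithin (hud t ht), trace_mul_comm, inv_def, Ring.inverse_eq_inv',
      Matrix.mul_smul, trace_smul, smul_eq_mul, div_eq_inv_mul]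
  have htr := hasDerivWithinAt_trace_mul_inv (hA' τ hτ) (hA'' τ hτ) (hinv τ hτ)
  have hpow := (Real.hasDerivAt_rpow_const (p := (3 : ℝ) / 2)
    (Or.inl hτ0.ne')).hasDerivWithinAt (s := Icc τ₁ τ₂)
  have hmain := (hpow.fun_mul htr.fun_neg).congr_of_mem
    (f₁ := fun t => t ^ ((3 : ℝ) / 2) * derivWithin α (Icc τ₁ τ₂) t)
    (fun t ht => by simp only [hderiv t ht]) hτ
  rw [hmain.derivWithin (hud τ hτ)]
  have hAA : A τ * (A τ)⁻¹ = 1 :=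
    mul_nonsing_inv _ ((isUnit_iff_isUnit_det _).1 (hinv τ hτ))
  have hsecond : A'' τ * (A τ)⁻¹ = M τ - (1 / (2 * τ)) • B τ := by
    rw [eq_sub_of_add_eq (hODE τ hτ), sub_mul, mul_assoc, hAA, mul_one, smul_mul, hB]
  have hsq : A' τ * ((A τ)⁻¹ * A' τ * (A τ)⁻¹) = B τ * B τ := by
    simp only [hB, mul_assoc]
  have hexpand : ((B τ - (1 / (2 * τ)) • (1 : Matrix (Fin n) (Fin n) ℝ)) ^ 2).trace
      = (B τ * B τ).trace - (1 / τ) * (B τ).trace + n / (4 * τ ^ 2) := by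
    simp only [sq, sub_mul, mul_sub, smul_mul, Matrix.mul_smul, one_mul, mul_one, trace_sub,
      trace_smul, trace_one, Fintype.card_fin, smul_eq_mul]
    field_simp
    ring
  have hneg : τ ^ (-(3 : ℝ) / 2) * τ ^ ((3 : ℝ) / 2) = 1 := by
    rw [← Real.rpow_add hτ0]
    norm_num
  have hsub : τ ^ ((3 : ℝ) / 2 - 1) = τ ^ ((3 : ℝ) / 2) / τ := Real.rpow_sub_one hτ0.ne' _
  rw [hsecond, hsq, ← hB, hexpand, hsub]
  simp only [trace_sub, trace_smul, smul_eq_mul]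
  linear_combination (-(3 / (2 * τ)) * (B τ).trace - (M τ).trace
    + 1 / (2 * τ) * (B τ).trace + (B τ * B τ).trace) * hneg
end

section
/- Let n ≥ 1, let 0 < τ₁ < τ₂, and let A : ℝ → Matrix (Fin n) (Fin n) ℝ be twice continuously differentiable on [τ₁,τ₂] with A(τ) invertible for every τ ∈ [τ₁,τ₂], and suppose A satisfies A''(τ) + (1/(2τ))·A'(τ) = M(τ)·A(τ) on [τ₁,τ₂], where M : ℝ → Matrix (Fin n) (Fin n) ℝ is continuous with M(τ) symmetric for every τ, and suppose B(τ₁) := A'(τ₁)·A(τ₁)⁻¹ is symmetric. Define α(τ) := -(1/2)·log(det(A(τ)ᵀ·A(τ))). Then for every τ ∈ [τ₁,τ₂]: d/dτ(√τ · α'(τ)) ≥ -√τ · trace(M(τ)). -/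
open Matrix Set

section EntrywiseCalculus

open scoped Matrix.Norms.Operator

variable {n : Type*} [Fintype n] {A : ℝ → Matrix n n ℝ} {A' : Matrix n n ℝ}
  {s : Set ℝ} {t : ℝ}

/-- Entrywise derivative of a product of matrices. -/
theorem hasDerivWithinAt_matrix_mul_apply {B : ℝ → Matrix n n ℝ} {B' : Matrix n n ℝ}
    (hA : ∀ i j, HasDerivWithinAt (fun x => A x i j) (A' i j) s t)
    (hB : ∀ i j, HasDerivWithinAt (fun x => B x i j) (B' i j) s t) (i j : n) :
    HasDerivWithinAt (fun x => (A x * B x) i j) ((A' * B t + A t * B') i j) s t := by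
  simp only [mul_apply, Matrix.add_apply, ← Finset.sum_add_distrib]
  exact HasDerivWithinAt.fun_sum fun k _ => (hA i k).mul (hB k j)

/-- Derivative of the trace of a matrix-valued function. -/
theorem hasDerivWithinAt_matrix_trace
    (hA : ∀ i j, HasDerivWithinAt (fun x => A x i j) (A' i j) s t) :
    HasDerivWithinAt (fun x => (A x).trace) A'.trace s t :=
  HasDerivWithinAt.fun_sum fun i _ => hA i i

variable [DecidableEq n]

/-- Entrywise derivative of the inverse of an invertible matrix. -/
theorem hasDerivWithinAt_matrix_inv_apply
    (hA : ∀ i j, HasDerivWithinAt (fun x => A x i j) (A' i j) s t) (hu : IsUnit (A t)) (i j : n) :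
    HasDerivWithinAt (fun x => (A x)⁻¹ i j) ((-((A t)⁻¹ * A' * (A t)⁻¹)) i j) s t := by
  have hmat : HasDerivWithinAt A A' s t :=
    hasDerivWithinAt_pi.2 fun i => hasDerivWithinAt_pi.2 fun j => hA i j
  obtain ⟨u, hu⟩ := hu
  have hinv := (hu ▸ hasFDerivAt_ringInverse (𝕜 := ℝ) u).comp_hasDerivWithinAt t hmat
  have hentry := hasDerivWithinAt_pi.1 (hasDerivWithinAt_pi.1 hinv i) j
  simpa [Function.comp_def, ← nonsing_inv_eq_ringInverse, ← hu, coe_units_inv] using hentry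

/-- Jacobi's formula for the derivative of the determinant. -/
theorem hasDerivWithinAt_matrix_det
    (hA : ∀ i j, HasDerivWithinAt (fun x => A x i j) (A' i j) s t) :
    HasDerivWithinAt (fun x => (A x).det) ((A t).adjugate * A').trace s t := by
  have htrace : ((A t).adjugate * A').trace =
      ∑ σ : Equiv.Perm n, (Equiv.Perm.sign σ : ℝ) *
        ∑ i, (∏ j ∈ Finset.univ.erase i, A t (σ j) j) * A' (σ i) i := by
    have hdiag (i : n) : ((A t).adjugate * A') i i =
        ((A t).updateCol i fun k => A' k i).det := by
      rw [← cramer_apply, cramer_eq_adjugate_mulVec]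
      rfl
    simp only [trace, diag_apply, hdiag, det_apply', Finset.mul_sum]
    rw [Finset.sum_comm]
    refine Finset.sum_congr rfl fun σ _ => Finset.sum_congr rfl fun i _ => ?_
    rw [← Finset.prod_erase_mul _ _ (Finset.mem_univ i), updateCol_self]
    congr 2
    refine Finset.prod_congr rfl fun j hj => ?_
    rw [updateCol_ne (Finset.ne_of_mem_erase hj)]
  rw [htrace]
  simp only [det_apply']
  refine HasDerivWithinAt.fun_sum fun σ _ => HasDerivWithinAt.const_mul _ ?_
  simpa using HasDerivWithinAt.fun_finsetProd (u := Finset.univ) fun i _ => hA (σ i) i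

end EntrywiseCalculus

/-- Logarithmic derivative of the Gram determinant of an invertible matrix. -/
theorem hasDerivWithinAt_log_det_transpose_mul_self {n : Type*} [Fintype n] [DecidableEq n]
    {A : ℝ → Matrix n n ℝ} {A' : Matrix n n ℝ} {s : Set ℝ} {t : ℝ}
    (hA : ∀ i j, HasDerivWithinAt (fun x => A x i j) (A' i j) s t) (hu : IsUnit (A t)) :
    HasDerivWithinAt (fun x => Real.log ((A x)ᵀ * A x).det) (2 * (A' * (A t)⁻¹).trace) s t := by
  have hdet : (A t).det ≠ 0 := ((isUnit_iff_isUnit_det _).1 hu).ne_zero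
  have hlog := ((hasDerivWithinAt_matrix_det hA).log hdet).const_mul 2
  have htr : (A' * (A t)⁻¹).trace = ((A t).adjugate * A').trace / (A t).det := by
    rw [inv_def, Ring.inverse_eq_inv', mul_smul_comm, trace_smul, trace_mul_comm, smul_eq_mul]
    ring
  rw [htr]
  convert! hlog using 2 with x
  rw [det_mul, det_transpose, ← sq, Real.log_pow]
  norm_num

/-- Along `A'' + (1 / (2τ)) A' = M A` with `M` symmetric, the symmetry of `A' A⁻¹` propagates from
the initial time. -/
theorem transpose_mul_inv_eq_of_second_order_ode {n : Type*} [Fintype n] [DecidableEq n]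
    {a b : ℝ} (ha : 0 < a) {A A' A'' M : ℝ → Matrix n n ℝ}
    (hA' : ∀ t ∈ Icc a b, ∀ i j, HasDerivWithinAt (fun x => A x i j) (A' t i j) (Icc a b) t)
    (hA'' : ∀ t ∈ Icc a b, ∀ i j, HasDerivWithinAt (fun x => A' x i j) (A'' t i j) (Icc a b) t)
    (hinv : ∀ t ∈ Icc a b, IsUnit (A t)) (hM : ∀ t ∈ Icc a b, (M t)ᵀ = M t)
    (hODE : ∀ t ∈ Icc a b, A'' t + (1 / (2 * t)) • A' t = M t * A t)
    (hinit : (A' a * (A a)⁻¹)ᵀ = A' a * (A a)⁻¹) {t : ℝ} (ht : t ∈ Icc a b) :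
    (A' t * (A t)⁻¹)ᵀ = A' t * (A t)⁻¹ := by
  have hsymm_iff (x : ℝ) (hx : x ∈ Icc a b) :
      (A' x * (A x)⁻¹)ᵀ = A' x * (A x)⁻¹ ↔ (A x)ᵀ * A' x = (A' x)ᵀ * A x := by
    have hdet := (isUnit_iff_isUnit_det _).1 (hinv x hx)
    have hdetT : IsUnit (A x)ᵀ.det := by rwa [det_transpose]
    rw [transpose_mul, transpose_nonsing_inv]
    constructor <;> intro h
    · calc (A x)ᵀ * A' x = (A x)ᵀ * (A' x * (A x)⁻¹) * A x := by
            rw [Matrix.mul_assoc, Matrix.mul_assoc, nonsing_inv_mul _ hdet, Matrix.mul_one]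
        _ = (A' x)ᵀ * A x := by rw [← h, mul_nonsing_inv_cancel_left _ _ hdetT]
    · calc ((A x)ᵀ)⁻¹ * (A' x)ᵀ = ((A x)ᵀ)⁻¹ * ((A' x)ᵀ * A x) * (A x)⁻¹ := by
            rw [Matrix.mul_assoc, mul_nonsing_inv_cancel_right _ _ hdet]
        _ = A' x * (A x)⁻¹ := by rw [← h, nonsing_inv_mul_cancel_left _ _ hdetT]
  have haIcc : a ∈ Icc a b := ⟨le_rfl, ht.1.trans ht.2⟩
  rw [hsymm_iff t ht]
  ext i j
  have hderiv (x : ℝ) (hx : x ∈ Icc a b) : HasDerivWithinAt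
      (fun y => √y * (((A y)ᵀ * A' y) i j - ((A' y)ᵀ * A y) i j)) 0 (Icc a b) x := by
    have hxpos : 0 < x := ha.trans_le hx.1
    have hsqrt := (Real.hasDerivAt_sqrt hxpos.ne').hasDerivWithinAt (s := Icc a b)
    have hW := (hasDerivWithinAt_matrix_mul_apply (A := fun y => (A y)ᵀ) (A' := (A' x)ᵀ)
      (fun k l => hA' x hx l k) (hA'' x hx) i j).sub
      (hasDerivWithinAt_matrix_mul_apply (A := fun y => (A' y)ᵀ) (A' := (A'' x)ᵀ)
      (fun k l => hA'' x hx l k) (hA' x hx) i j)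
    refine (hsqrt.mul hW).congr_deriv ?_
    have hA''x : A'' x = M x * A x - (1 / (2 * x)) • A' x := eq_sub_of_add_eq (hODE x hx)
    have hsq : √x * √x = x := Real.mul_self_sqrt hxpos.le
    have hsx : √x ≠ 0 := (Real.sqrt_pos.2 hxpos).ne'
    have hcoef : 1 / (2 * √x) = √x * (1 / (2 * x)) := by
      field_simp
      linarith
    rw [hA''x, transpose_sub, transpose_mul, transpose_smul, hM x hx]
    simp only [Matrix.mul_sub, Matrix.sub_mul, mul_smul_comm, smul_mul_assoc, Matrix.add_apply,
      Matrix.sub_apply, Matrix.smul_apply, smul_eq_mul, Matrix.mul_assoc, hcoef, Pi.sub_apply]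
    ring
  have hconst := constant_of_derivWithin_zero (fun x hx => (hderiv x hx).differentiableWithinAt)
    (fun x hx => by
      have hx' : x ∈ Icc a b := Ico_subset_Icc_self hx
      exact (hderiv x hx').derivWithin (uniqueDiffOn_Icc (hx.1.trans_lt hx.2) x hx')) t ht
  have hzero : √t * (((A t)ᵀ * A' t) i j - ((A' t)ᵀ * A t) i j) = 0 := by
    rw [hconst, (hsymm_iff a haIcc).1 hinit, sub_self, mul_zero]
  exact sub_eq_zero.1
    ((mul_eq_zero.1 hzero).resolve_left (Real.sqrt_pos.2 (ha.trans_le ht.1)).ne')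

theorem matrix_ode_first_differential_inequality
    (n : ℕ) (hn : 1 ≤ n) (τ₁ τ₂ : ℝ) (hτ₁ : 0 < τ₁) (hτ₁₂ : τ₁ < τ₂)
    (A A' A'' M : ℝ → Matrix (Fin n) (Fin n) ℝ)
    -- A is twice continuously differentiable on [τ₁,τ₂], with entrywise
    -- first derivative A' and second derivative A''
    (hA' : ∀ τ ∈ Icc τ₁ τ₂, ∀ i j,
      HasDerivWithinAt (fun t => A t i j) (A' τ i j) (Icc τ₁ τ₂) τ)
    (hA'' : ∀ τ ∈ Icc τ₁ τ₂, ∀ i j,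
      HasDerivWithinAt (fun t => A' t i j) (A'' τ i j) (Icc τ₁ τ₂) τ)
    (hA''cont : ∀ i j, ContinuousOn (fun t => A'' t i j) (Icc τ₁ τ₂))
    -- A(τ) is invertible on [τ₁,τ₂]
    (hinv : ∀ τ ∈ Icc τ₁ τ₂, IsUnit (A τ))
    -- M is continuous, and M(τ) is symmetric for every τ
    (hM : ∀ i j, ContinuousOn (fun t => M t i j) (Icc τ₁ τ₂))
    (hMsymm : ∀ τ ∈ Icc τ₁ τ₂, (M τ)ᵀ = M τ)
    -- the second-order linear ODE  A'' + (1/(2τ))·A' = M·A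
    (hODE : ∀ τ ∈ Icc τ₁ τ₂, A'' τ + (1 / (2 * τ)) • A' τ = M τ * A τ)
    -- B(τ₁) := A'(τ₁)·A(τ₁)⁻¹ is symmetric
    (hB₁symm : (A' τ₁ * (A τ₁)⁻¹)ᵀ = A' τ₁ * (A τ₁)⁻¹)
    -- α(τ) := -(1/2)·log det(Aᵀ A)
    (α : ℝ → ℝ) (hα : ∀ τ, α τ = -(1 / 2) * Real.log ((A τ)ᵀ * A τ).det) :
    ∀ τ ∈ Icc τ₁ τ₂,
      derivWithin (fun t => Real.sqrt t * derivWithin α (Icc τ₁ τ₂) t) (Icc τ₁ τ₂) τ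
        ≥ -(Real.sqrt τ) * (M τ).trace := by
  intro τ hτ
  have hunique : UniqueDiffOn ℝ (Icc τ₁ τ₂) := uniqueDiffOn_Icc hτ₁₂
  have hα' (t : ℝ) (ht : t ∈ Icc τ₁ τ₂) :
      derivWithin α (Icc τ₁ τ₂) t = -(A' t * (A t)⁻¹).trace := by
    rw [funext hα, ((hasDerivWithinAt_log_det_transpose_mul_self (hA' t ht)
      (hinv t ht)).const_mul (-(1 / 2))).derivWithin (hunique t ht)]
    ring
  have hτpos : 0 < τ := hτ₁.trans_le hτ.1
  have hdet := (isUnit_iff_isUnit_det _).1 (hinv τ hτ)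
  have htrace := hasDerivWithinAt_matrix_trace (hasDerivWithinAt_matrix_mul_apply (hA'' τ hτ)
    (hasDerivWithinAt_matrix_inv_apply (hA' τ hτ) (hinv τ hτ)))
  have hderiv := ((Real.hasDerivAt_sqrt hτpos.ne').hasDerivWithinAt (s := Icc τ₁ τ₂)).mul htrace.neg
  have hB := transpose_mul_inv_eq_of_second_order_ode hτ₁ hA' hA'' hinv hMsymm hODE hB₁symm hτ
  rw [derivWithin_congr (fun t ht => by rw [hα' t ht]) (by rw [hα' τ hτ])]
  rw [show (fun t => √t * -(A' t * (A t)⁻¹).trace) =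
    Real.sqrt * -(fun t => (A' t * (A t)⁻¹).trace) from rfl, hderiv.derivWithin (hunique τ hτ)]
  have hA''B : A'' τ * (A τ)⁻¹ = M τ - (1 / (2 * τ)) • (A' τ * (A τ)⁻¹) := by
    rw [eq_sub_of_add_eq (hODE τ hτ), Matrix.sub_mul, mul_nonsing_inv_cancel_right _ _ hdet,
      smul_mul_assoc]
  have hsq : A' τ * -((A τ)⁻¹ * A' τ * (A τ)⁻¹) =
      -((A' τ * (A τ)⁻¹)ᵀ * (A' τ * (A τ)⁻¹)) := by
    rw [hB]
    simp only [Matrix.mul_neg, Matrix.mul_assoc]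
  have hnonneg : 0 ≤ ((A' τ * (A τ)⁻¹)ᵀ * (A' τ * (A τ)⁻¹)).trace := by
    simpa [conjTranspose_eq_transpose_of_trivial] using
      (posSemidef_conjTranspose_mul_self (A' τ * (A τ)⁻¹)).trace_nonneg
  have hsqrt_pos : 0 < √τ := Real.sqrt_pos.2 hτpos
  have hcoef : 1 / (2 * √τ) = √τ * (1 / (2 * τ)) := by
    have hself : √τ * √τ = τ := Real.mul_self_sqrt hτpos.le
    field_simp
    linarith
  rw [hA''B, hsq, trace_add, trace_sub, trace_neg, trace_smul, smul_eq_mul, hcoef]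
  simp only [Pi.neg_apply]
  nlinarith [mul_nonneg hsqrt_pos.le hnonneg]
end
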